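/- Let k be a field of characteristic zero, complete with respect to a nontrivial non-Archimedean absolute value, let n,l ≥ 1, r > 0, M > 0, and let G be a function from k^n to the n×l matrices over k that is analytic on the open ball B₀(0,r) = {x ∈ k^n : ‖x‖ < r} and satisfies ‖G(x)‖ ≤ M and ‖G(x) − G(y)‖ ≤ (M/r)‖x − y‖ for all x,y with ‖x‖,‖y‖ ≤ r. Then there exists a function H : k^l × k^n → k^n, analytic on the set {(u,w) : ‖u‖ < r/M, ‖w‖ < r}, such that for every (u,w) in this set one has ‖H(u,w)‖ < r, H(u,w) = w + G(H(u,w))·u, and H(u,w) is the unique point h with ‖h‖ ≤ r satisfying h = w + G(h)·u. -/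

import Mathlib

open Filter Topology

/-- Inverse function theorem for analytic maps between finite-dimensional spaces: an endomap with
injective derivative has an analytic local right inverse. -/
theorem AnalyticAt.exists_analyticAt_rightInverse {k E : Type*} [NontriviallyNormedField k]
    [CompleteSpace k] [NormedAddCommGroup E] [NormedSpace k E]
    [FiniteDimensional k E] {f : E → E} {a : E} (hf : AnalyticAt k f a)
    (hinj : Function.Injective (fderiv k f a)) :
    ∃ g : E → E, AnalyticAt k g (f a) ∧ g (f a) = a ∧ ∀ᶠ y in 𝓝 (f a), f (g y) = y := by
  have : CompleteSpace E := FiniteDimensional.complete k E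
  let e : E ≃L[k] E :=
    (LinearEquiv.ofInjectiveEndo (fderiv k f a : E →ₗ[k] E) hinj).toContinuousLinearEquiv
  have he : (e : E →L[k] E) = fderiv k f a := by
    ext x
    simp [e]
  have hfe : HasStrictFDerivAt f (e : E →L[k] E) a := he ▸ hf.hasStrictFDerivAt
  exact ⟨hfe.localInverse f e a,
    (hfe.toOpenPartialHomeomorph f).analyticAt_symm' hfe.mem_toOpenPartialHomeomorph_source hf
      he.symm,
    hfe.localInverse_apply_image, hfe.eventually_right_inverse⟩

/-- Over an ultrametric field, the sup norm of matrices is compatible with the sup norm of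
vectors. -/
theorem IsUltrametricDist.norm_matrix_apply_le {k ι κ : Type*} [NormedField k]
    [IsUltrametricDist k] [Fintype ι] [Fintype κ] (A : ι → κ → k) (u : κ → k) :
    ‖fun i => ∑ j, A i j * u j‖ ≤ ‖A‖ * ‖u‖ := by
  refine (pi_norm_le_iff_of_nonneg (by positivity)).2 fun i => ?_
  refine IsUltrametricDist.norm_sum_le_of_forall_le_of_nonneg (by positivity) fun j _ => ?_
  rw [norm_mul]
  exact mul_le_mul ((norm_le_pi_norm (A i) j).trans (norm_le_pi_norm A i)) (norm_le_pi_norm u j)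
    (norm_nonneg _) (norm_nonneg _)

/-- An analytic family of self-maps of `F` which are Lipschitz with constant `C < 1` near `h₀`
admits an analytic family of solutions of the perturbed fixed point equation
`h = w + ψ (u, h)`. -/
theorem AnalyticAt.exists_analyticAt_fixedPoint {k E F : Type*} [NontriviallyNormedField k]
    [CompleteSpace k] [NormedAddCommGroup E] [NormedSpace k E]
    [FiniteDimensional k E] [NormedAddCommGroup F] [NormedSpace k F] [FiniteDimensional k F]
    {ψ : E × F → F} {u₀ : E} {w₀ h₀ : F} (hψ : AnalyticAt k ψ (u₀, h₀))
    (h_eq : h₀ = w₀ + ψ (u₀, h₀)) {C : ℝ} (hC₀ : 0 ≤ C) (hC₁ : C < 1)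
    (hlip : ∀ᶠ h in 𝓝 h₀, ‖ψ (u₀, h) - ψ (u₀, h₀)‖ ≤ C * ‖h - h₀‖) :
    ∃ g : E × F → F, AnalyticAt k g (u₀, w₀) ∧ g (u₀, w₀) = h₀ ∧
      ∀ᶠ p in 𝓝 (u₀, w₀), g p = p.2 + ψ (p.1, g p) := by
  let Φ : E × F → E × F := fun p => (p.1, p.2 - ψ p)
  have hΦ : AnalyticAt k Φ (u₀, h₀) := analyticAt_fst.prod (analyticAt_snd.sub hψ)
  have hΦ₀ : Φ (u₀, h₀) = (u₀, w₀) := by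
    simp only [Φ, Prod.mk.injEq, true_and]
    exact sub_eq_of_eq_add h_eq
  have hD : HasFDerivAt ψ (fderiv k ψ (u₀, h₀)) (u₀, h₀) := hψ.differentiableAt.hasFDerivAt
  have hΦ' : fderiv k Φ (u₀, h₀) = (ContinuousLinearMap.fst k E F).prod
      (ContinuousLinearMap.snd k E F - fderiv k ψ (u₀, h₀)) :=
    (hasFDerivAt_fst.prodMk (hasFDerivAt_snd.sub hD)).fderiv
  have hpart : HasFDerivAt (fun h => ψ (u₀, h))
      ((fderiv k ψ (u₀, h₀)).comp (ContinuousLinearMap.inr k E F)) h₀ :=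
    hD.comp h₀ (hasFDerivAt_prodMk_right u₀ h₀)
  have hnorm := hpart.le_of_lip' hC₀ hlip
  have hinj : Function.Injective (fderiv k Φ (u₀, h₀)) := by
    refine (injective_iff_map_eq_zero _).2 fun v hv => ?_
    obtain ⟨x, y⟩ := v
    rw [hΦ'] at hv
    simp only [ContinuousLinearMap.prod_apply, ContinuousLinearMap.coe_fst',
      sub_apply, ContinuousLinearMap.coe_snd', Prod.mk_eq_zero] at hv
    obtain ⟨rfl, hy⟩ := hv
    have hy' : ‖y‖ ≤ C * ‖y‖ :=
      calc ‖y‖ = ‖((fderiv k ψ (u₀, h₀)).comp (ContinuousLinearMap.inr k E F)) y‖ := by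
            simpa using congrArg norm (sub_eq_zero.1 hy)
        _ ≤ C * ‖y‖ := ContinuousLinearMap.le_of_opNorm_le _ hnorm y
    have : ‖y‖ = 0 := by nlinarith [norm_nonneg y]
    simpa using this
  obtain ⟨g, hg, hg₀, hginv⟩ := hΦ.exists_analyticAt_rightInverse hinj
  rw [hΦ₀] at hg hg₀ hginv
  refine ⟨fun p => (g p).2, analyticAt_snd.comp hg, by simp [hg₀], ?_⟩
  filter_upwards [hginv] with p hp
  obtain ⟨h₁, h₂⟩ : (g p).1 = p.1 ∧ (g p).2 - ψ (g p) = p.2 := Prod.ext_iff.1 hp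
  rw [← h₁, ← h₂]
  simp


/-- **Analytic Lagrange inversion on a non-Archimedean field.**
If `G` is analytic on the open ball of radius `r` of `kⁿ` (values in `n × l`
matrices over `k`, sup norm of entries), bounded by `M` and `(M/r)`-Lipschitz on
the closed ball of radius `r`, then there is a function `H(u,w)`, analytic on
`{(u,w) : ‖u‖ < r/M, ‖w‖ < r}`, with `‖H(u,w)‖ < r`, solving
`H(u,w) = w + G(H(u,w))·u`, and `H(u,w)` is the unique solution `h` with `‖h‖ ≤ r`. -/
theorem stmt_1
    {k : Type*} [NontriviallyNormedField k] [CompleteSpace k] [CharZero k]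
    (hultra : IsUltrametricDist k)
    {n l : ℕ} (hn : 1 ≤ n) (hl : 1 ≤ l)
    (r M : ℝ) (hr : 0 < r) (hM : 0 < M)
    (G : (Fin n → k) → (Fin n → Fin l → k))
    (hGan : AnalyticOnNhd k G {x : Fin n → k | ‖x‖ < r})
    (hGbd : ∀ x : Fin n → k, ‖x‖ ≤ r → ‖G x‖ ≤ M)
    (hGlip : ∀ x y : Fin n → k, ‖x‖ ≤ r → ‖y‖ ≤ r →
      ‖G x - G y‖ ≤ (M / r) * ‖x - y‖) :
    ∃ H : (Fin l → k) × (Fin n → k) → (Fin n → k),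
      AnalyticOnNhd k H {p : (Fin l → k) × (Fin n → k) | ‖p.1‖ < r / M ∧ ‖p.2‖ < r} ∧
      ∀ u : Fin l → k, ∀ w : Fin n → k, ‖u‖ < r / M → ‖w‖ < r →
        ‖H (u, w)‖ < r ∧
        H (u, w) = w + (fun i => ∑ j, G (H (u, w)) i j * u j) ∧
        ∀ h : Fin n → k, ‖h‖ ≤ r →
          h = w + (fun i => ∑ j, G h i j * u j) → h = H (u, w) := by
  have hball : ∀ x : Fin n → k, ‖x‖ < r → ∀ᶠ y in 𝓝 x, ‖y‖ < r := fun x hx =>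
    continuous_norm.continuousAt.eventually_lt continuousAt_const hx
  let ψ : (Fin l → k) × (Fin n → k) → (Fin n → k) := fun p i => ∑ j, G p.2 i j * p.1 j
  have hψbd : ∀ u h, ‖u‖ < r / M → ‖h‖ ≤ r → ‖ψ (u, h)‖ < r := fun u h hu hh =>
    calc ‖ψ (u, h)‖ ≤ ‖G h‖ * ‖u‖ := IsUltrametricDist.norm_matrix_apply_le _ _
      _ ≤ M * ‖u‖ := by gcongr; exact hGbd h hh
      _ < r := by rwa [mul_comm, ← lt_div_iff₀ hM]
  have hψlip : ∀ u x y, ‖x‖ ≤ r → ‖y‖ ≤ r →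
      ‖ψ (u, x) - ψ (u, y)‖ ≤ M / r * ‖u‖ * ‖x - y‖ := fun u x y hx hy =>
    calc ‖ψ (u, x) - ψ (u, y)‖ = ‖fun i => ∑ j, (G x - G y) i j * u j‖ := by
          congr 1
          ext i
          simp [ψ, sub_mul]
      _ ≤ ‖G x - G y‖ * ‖u‖ := IsUltrametricDist.norm_matrix_apply_le _ _
      _ ≤ M / r * ‖x - y‖ * ‖u‖ := by gcongr; exact hGlip x y hx hy
      _ = M / r * ‖u‖ * ‖x - y‖ := by ring
  have hC₀ : ∀ u : Fin l → k, 0 ≤ M / r * ‖u‖ := fun u => by positivity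
  have hC₁ : ∀ u : Fin l → k, ‖u‖ < r / M → M / r * ‖u‖ < 1 := fun u hu =>
    calc M / r * ‖u‖ < M / r * (r / M) := by gcongr
      _ = 1 := by field_simp
  have hmap : ∀ u w h, ‖u‖ < r / M → ‖w‖ < r → ‖h‖ ≤ r → ‖w + ψ (u, h)‖ < r :=
    fun u w h hu hw hh =>
      (IsUltrametricDist.norm_add_le_max _ _).trans_lt (max_lt hw (hψbd u h hu hh))
  have huniq : ∀ u w x y, ‖u‖ < r / M → ‖x‖ ≤ r → ‖y‖ ≤ r →
      x = w + ψ (u, x) → y = w + ψ (u, y) → x = y := by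
    intro u w x y hu hx hy hxe hye
    have hle : ‖x - y‖ ≤ M / r * ‖u‖ * ‖x - y‖ :=
      calc ‖x - y‖ = ‖ψ (u, x) - ψ (u, y)‖ := by
            conv_lhs => rw [hxe, hye, add_sub_add_left_eq_sub]
        _ ≤ _ := hψlip u x y hx hy
    have hzero : ‖x - y‖ = 0 := by nlinarith [norm_nonneg (x - y), hC₁ u hu]
    exact sub_eq_zero.1 (norm_eq_zero.1 hzero)
  have hex : ∀ p : (Fin l → k) × (Fin n → k), ‖p.1‖ < r / M ∧ ‖p.2‖ < r →
      ∃ h, ‖h‖ ≤ r ∧ h = p.2 + ψ (p.1, h) := by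
    rintro ⟨u, w⟩ ⟨hu, hw⟩
    have hmaps : Set.MapsTo (fun h => w + ψ (u, h)) (Metric.closedBall 0 r)
        (Metric.closedBall 0 r) := fun h hh => by
      rw [mem_closedBall_zero_iff] at hh ⊢
      exact (hmap u w h hu hw hh).le
    have hcontr : ContractingWith ⟨M / r * ‖u‖, hC₀ u⟩ (hmaps.restrict _ _ _) := by
      refine ⟨hC₁ u hu, LipschitzWith.of_dist_le_mul fun x y => ?_⟩
      rw [Subtype.dist_eq, Subtype.dist_eq, dist_eq_norm, dist_eq_norm]
      exact (congrArg norm (add_sub_add_left_eq_sub _ _ _)).trans_le (hψlip u x y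
        (mem_closedBall_zero_iff.1 x.2) (mem_closedBall_zero_iff.1 y.2))
    obtain ⟨h, hh, hfix, -⟩ := hcontr.exists_fixedPoint' Metric.isClosed_closedBall.isComplete
      hmaps (Metric.mem_closedBall_self hr.le) (edist_ne_top _ _)
    exact ⟨h, mem_closedBall_zero_iff.1 hh, hfix.symm⟩
  choose! H hHle hHeq using hex
  have hHlt : ∀ p : (Fin l → k) × (Fin n → k), ‖p.1‖ < r / M ∧ ‖p.2‖ < r → ‖H p‖ < r :=
    fun p hp => by
      rw [hHeq p hp]
      exact hmap p.1 p.2 (H p) hp.1 hp.2 (hHle p hp)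
  refine ⟨H, ?_, fun u w hu hw => ⟨hHlt (u, w) ⟨hu, hw⟩, hHeq (u, w) ⟨hu, hw⟩, fun h hh he =>
    huniq u w h _ hu hh (hHle (u, w) ⟨hu, hw⟩) he (hHeq (u, w) ⟨hu, hw⟩)⟩⟩
  rintro ⟨u, w⟩ ⟨hu, hw⟩
  have hlt := hHlt (u, w) ⟨hu, hw⟩
  have hψan : AnalyticAt k ψ (u, H (u, w)) := by
    have hG : AnalyticAt k (fun p : (Fin l → k) × (Fin n → k) => G p.2) (u, H (u, w)) :=
      AnalyticAt.fun_comp (g := G) (f := Prod.snd) (hGan _ hlt) analyticAt_snd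
    refine AnalyticAt.pi fun i => Finset.analyticAt_fun_sum _ fun j _ => ?_
    exact (analyticAt_pi_iff.1 (analyticAt_pi_iff.1 hG i) j).mul
      (analyticAt_pi_iff.1 analyticAt_fst j)
  obtain ⟨g, hg, hg₀, hgeq⟩ := hψan.exists_analyticAt_fixedPoint (hHeq (u, w) ⟨hu, hw⟩)
    (hC₀ u) (hC₁ u hu) ((hball _ hlt).mono fun h hh => hψlip u h _ hh.le hlt.le)
  refine hg.congr ?_
  have hgball : ∀ᶠ p in 𝓝 (u, w), ‖g p‖ < r :=
    hg.continuousAt.eventually (hball _ (hg₀ ▸ hlt))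
  have hfst : ∀ᶠ p : (Fin l → k) × (Fin n → k) in 𝓝 (u, w), ‖p.1‖ < r / M :=
    continuous_fst.norm.continuousAt.eventually_lt continuousAt_const hu
  have hsnd : ∀ᶠ p : (Fin l → k) × (Fin n → k) in 𝓝 (u, w), ‖p.2‖ < r :=
    continuous_snd.norm.continuousAt.eventually_lt continuousAt_const hw
  filter_upwards [hgeq, hgball, hfst, hsnd] with p hp hpr hp₁ hp₂
  exact huniq p.1 p.2 _ _ hp₁ hpr.le (hHle p ⟨hp₁, hp₂⟩) hp (hHeq p ⟨hp₁, hp₂⟩)
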